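/- arXiv:2101.03354 — 2 statements merged into one kernel-verified Lean document; each statement's English description precedes it below -/
import Mathlib

section
/- There exists t₀ > 0 such that for every t ∈ (0,t₀), the zero level set {z ∈ ℝ^N : u(z,t) = 0} intersected with the open ball B_{t^{1/(2s)}} is locally a C^1 graph over the first N−1 coordinates: for every z₀ in this intersection there exist an open set U ⊂ ℝ^N containing z₀, an open set V ⊂ ℝ^{N-1} containing z₀' (the first N−1 coordinates of z₀), and a C^1 function g : V → ℝ such that {z ∈ U : u(z,t) = 0} = {(z', g(z')) : z' ∈ V} ∩ U. -/
open MeasureTheory Metric Real Set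

noncomputable section

/-- Append a last coordinate: `(y', a) ∈ ℝ^{N-1} × ℝ ↦ ℝ^N`. -/
def snocPt {d : ℕ} (y' : EuclideanSpace ℝ (Fin d)) (a : ℝ) :
    EuclideanSpace ℝ (Fin (d + 1)) :=
  (EuclideanSpace.equiv (Fin (d + 1)) ℝ).symm
    (Fin.snoc ((EuclideanSpace.equiv (Fin d) ℝ) y') a)

/-- The last standard basis vector `e_N` of `ℝ^N`. -/
def eN (d : ℕ) : EuclideanSpace ℝ (Fin (d + 1)) :=
  EuclideanSpace.single (Fin.last d) 1

/-- `τ_E = 𝟙_E − 𝟙_{ℝ^N ∖ cl E}`. -/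
def tauE {d : ℕ} (E : Set (EuclideanSpace ℝ (Fin (d + 1))))
    (y : EuclideanSpace ℝ (Fin (d + 1))) : ℝ :=
  Set.indicator E (fun _ => 1) y - Set.indicator (closure E)ᶜ (fun _ => 1) y

/-- The kernel `𝒦_s(x,t) = t^{-N/(2s)} P_s(t^{-1/(2s)} x)` with `N = d+1`. -/
def ker {d : ℕ} (s : ℝ) (P : EuclideanSpace ℝ (Fin (d + 1)) → ℝ)
    (x : EuclideanSpace ℝ (Fin (d + 1))) (t : ℝ) : ℝ :=
  t ^ (-(((d : ℝ) + 1) / (2 * s))) * P ((t ^ (-(1 : ℝ) / (2 * s))) • x)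

/-- `u(x,t) = ∫_{ℝ^N} 𝒦_s(x−y,t) τ_E(y) dy`. -/
def uF {d : ℕ} (s : ℝ) (P : EuclideanSpace ℝ (Fin (d + 1)) → ℝ)
    (E : Set (EuclideanSpace ℝ (Fin (d + 1)))) (x : EuclideanSpace ℝ (Fin (d + 1)))
    (t : ℝ) : ℝ :=
  ∫ y, ker s P (x - y) t * tauE E y


/-- First `N−1` coordinates of a point of `ℝ^N`. -/
def projHead {d : ℕ} (z : EuclideanSpace ℝ (Fin (d + 1))) : EuclideanSpace ℝ (Fin d) :=
  (EuclideanSpace.equiv (Fin d) ℝ).symm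
    (fun i => (EuclideanSpace.equiv (Fin (d + 1)) ℝ) z i.castSucc)

open scoped Topology

section Coordinates

variable {d : ℕ}

@[simp]
theorem projHead_apply (z : EuclideanSpace ℝ (Fin (d + 1))) (i : Fin d) :
    projHead z i = z i.castSucc := rfl

@[simp]
theorem snocPt_castSucc (y' : EuclideanSpace ℝ (Fin d)) (a : ℝ) (i : Fin d) :
    snocPt y' a i.castSucc = y' i := by
  simp [snocPt]

@[simp]
theorem snocPt_last (y' : EuclideanSpace ℝ (Fin d)) (a : ℝ) :
    snocPt y' a (Fin.last d) = a := by
  simp [snocPt]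

theorem snocPt_projHead (z : EuclideanSpace ℝ (Fin (d + 1))) :
    snocPt (projHead z) (z (Fin.last d)) = z := by
  ext i
  refine Fin.lastCases ?_ (fun i => ?_) i <;> simp

@[simp]
theorem projHead_snocPt (y' : EuclideanSpace ℝ (Fin d)) (a : ℝ) :
    projHead (snocPt y' a) = y' := by
  ext i
  simp

@[simp]
theorem eN_castSucc (i : Fin d) : eN d i.castSucc = 0 := by
  simp [eN, (Fin.castSucc_lt_last i).ne]

@[simp]
theorem eN_last : eN d (Fin.last d) = 1 := by
  simp [eN]

@[simp]
theorem norm_eN : ‖eN d‖ = 1 := by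
  simp [eN]

theorem contDiff_snocPt_const (a : ℝ) {n : WithTop ℕ∞} :
    ContDiff ℝ n (fun y' : EuclideanSpace ℝ (Fin d) => snocPt y' a) := by
  refine contDiff_euclidean.2 fun i => ?_
  refine Fin.lastCases ?_ (fun i => ?_) i
  · simpa using contDiff_const
  · simpa using contDiff_euclidean.1 contDiff_id i

theorem continuous_projHead :
    Continuous (projHead : EuclideanSpace ℝ (Fin (d + 1)) → EuclideanSpace ℝ (Fin d)) := by
  unfold projHead
  fun_prop

/-- Implicit function theorem: near a zero where the last partial derivative does not vanish, the
zero set of a `C¹` function is the graph of a `C¹` function of the first coordinates. -/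
theorem exists_contDiffOn_graph_of_fderiv_ne_zero
    {G : EuclideanSpace ℝ (Fin (d + 1)) → ℝ} (hG : ContDiff ℝ 1 G)
    {z₀ : EuclideanSpace ℝ (Fin (d + 1))} (h0 : G z₀ = 0) (hne : fderiv ℝ G z₀ (eN d) ≠ 0) :
    ∃ U : Set (EuclideanSpace ℝ (Fin (d + 1))), IsOpen U ∧ z₀ ∈ U ∧
      ∃ V : Set (EuclideanSpace ℝ (Fin d)), IsOpen V ∧ projHead z₀ ∈ V ∧
      ∃ g : EuclideanSpace ℝ (Fin d) → ℝ, ContDiffOn ℝ 1 g V ∧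
        {z ∈ U | G z = 0} = ((fun z' => snocPt z' (g z')) '' V) ∩ U := by
  set Φ : EuclideanSpace ℝ (Fin (d + 1)) → EuclideanSpace ℝ (Fin (d + 1)) :=
    fun z => z + (G z - z (Fin.last d)) • eN d with hΦ
  have hΦeq (z) : Φ z = snocPt (projHead z) (G z) := by
    ext i
    refine Fin.lastCases ?_ (fun i => ?_) i <;> simp [hΦ]
  set pr : EuclideanSpace ℝ (Fin (d + 1)) →L[ℝ] ℝ := EuclideanSpace.proj (Fin.last d) with hprj
  set A : EuclideanSpace ℝ (Fin (d + 1)) →L[ℝ] EuclideanSpace ℝ (Fin (d + 1)) :=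
    ContinuousLinearMap.id ℝ _ + (fderiv ℝ G z₀ - pr).smulRight (eN d) with hA
  have hΦA : HasFDerivAt Φ A z₀ :=
    (hasFDerivAt_id z₀).add
      (((hG.differentiable (by norm_num) z₀).hasFDerivAt.sub pr.hasFDerivAt).smul_const (eN d))
  have hΦ1 : ContDiff ℝ 1 Φ := contDiff_id.add ((hG.sub pr.contDiff).smul contDiff_const)
  have hinj : Function.Injective A := by
    rw [injective_iff_map_eq_zero]
    intro v hv
    have hAv (i) : v i + (fderiv ℝ G z₀ v - v (Fin.last d)) * eN d i = 0 := by
      have := congrArg (fun w : EuclideanSpace ℝ (Fin (d + 1)) => w i) hv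
      simpa [hA, hprj] using this
    have h1 : v = v (Fin.last d) • eN d := by
      ext i
      refine Fin.lastCases (by simp) (fun i => ?_) i
      simpa using hAv i.castSucc
    have h2 : fderiv ℝ G z₀ v = 0 := by simpa using hAv (Fin.last d)
    have h3 : v (Fin.last d) * fderiv ℝ G z₀ (eN d) = 0 := by
      rw [h1] at h2
      simpa using h2
    rw [h1, (mul_eq_zero.1 h3).resolve_right hne, zero_smul]
  set A' := (LinearEquiv.ofInjectiveEndo A.toLinearMap hinj).toContinuousLinearEquiv with hA'
  have hΦA' : HasFDerivAt Φ (A' : _ →L[ℝ] _) z₀ := by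
    have hAA : (A' : _ →L[ℝ] _) = A := by ext v : 1; rfl
    rwa [hAA]
  set e := hΦ1.contDiffAt.toOpenPartialHomeomorph Φ hΦA' one_ne_zero with he
  have hcoe : (e : _ → _) = Φ := rfl
  have hz₀ : z₀ ∈ e.source := hΦ1.contDiffAt.mem_toOpenPartialHomeomorph_source hΦA' one_ne_zero
  have hsymm : ContDiffAt ℝ 1 e.symm (Φ z₀) := hΦ1.contDiffAt.to_localInverse hΦA' one_ne_zero
  obtain ⟨T, hT, hTs⟩ := (hsymm.eventually (by simp)).exists_mem
  obtain ⟨T', hT'T, hT'o, hT'm⟩ := _root_.mem_nhds_iff.1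
    (Filter.inter_mem hT (e.open_target.mem_nhds (e.map_source hz₀)))
  refine ⟨e.source ∩ Φ ⁻¹' T', e.open_source.inter (hT'o.preimage hΦ1.continuous),
    ⟨hz₀, hT'm⟩, (fun y' => snocPt y' 0) ⁻¹' T',
    hT'o.preimage (contDiff_snocPt_const (n := 1) 0).continuous, ?_,
    fun z' => e.symm (snocPt z' 0) (Fin.last d), ?_, ?_⟩
  · have := hΦeq z₀
    rw [h0] at this
    simpa [← this] using hT'm
  · intro y' hy'
    exact (pr.contDiff.contDiffAt.comp y' ((hTs _ (hT'T hy').1).comp y'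
      (contDiff_snocPt_const 0).contDiffAt)).contDiffWithinAt
  · ext z
    constructor
    · rintro ⟨⟨hzs, hzT⟩, hz⟩
      have hΦz : Φ z = snocPt (projHead z) 0 := by rw [hΦeq, hz]
      refine ⟨⟨projHead z, by simpa [← hΦz] using hzT, ?_⟩, hzs, hzT⟩
      have : e.symm (snocPt (projHead z) 0) = z := by
        rw [← hΦz, ← hcoe, e.left_inv hzs]
      simp only [this, snocPt_projHead]
    · rintro ⟨⟨z', hz', rfl⟩, hzU⟩
      refine ⟨hzU, ?_⟩
      have h1 : Φ (e.symm (snocPt z' 0)) = snocPt z' 0 := by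
        rw [← hcoe, e.right_inv (hT'T hz').2]
      rw [hΦeq] at h1
      have h2 := congrArg projHead h1
      have h3 := congrArg (fun w => w (Fin.last d)) h1
      simp only [projHead_snocPt, snocPt_last] at h2 h3
      have h4 := snocPt_projHead (e.symm (snocPt z' 0))
      rw [h2] at h4
      simpa only [h4] using h3

end Coordinates

section Convolution

theorem inv_one_add_norm_sub_rpow_le {V : Type*} [NormedAddCommGroup V] {p R : ℝ} (hp : 0 ≤ p)
    {x : V} (hx : ‖x‖ ≤ R) (y : V) :
    (1 + ‖x - y‖ ^ p)⁻¹ ≤ 2 ^ p * (1 + R) ^ p * (1 + ‖y‖) ^ (-p) := by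
  have hR : 0 ≤ R := (norm_nonneg x).trans hx
  have h1 : 1 + ‖y‖ ≤ (1 + R) * (1 + ‖x - y‖) := by
    have : ‖y‖ ≤ ‖x‖ + ‖x - y‖ := by
      simpa using norm_sub_le x (x - y)
    nlinarith [norm_nonneg (x - y)]
  have h2 : (1 + ‖x - y‖) ^ p ≤ 2 ^ p * (1 + ‖x - y‖ ^ p) := by
    have h3 : 1 + ‖x - y‖ ≤ 2 * max 1 ‖x - y‖ := by
      linarith [le_max_left 1 ‖x - y‖, le_max_right 1 ‖x - y‖]
    calc (1 + ‖x - y‖) ^ p ≤ (2 * max 1 ‖x - y‖) ^ p := by gcongr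
      _ = 2 ^ p * (max 1 ‖x - y‖) ^ p := mul_rpow (by norm_num) (by positivity)
      _ ≤ 2 ^ p * (1 + ‖x - y‖ ^ p) := by
        gcongr
        rcases max_cases 1 ‖x - y‖ with h | h <;> rw [h.1]
        · simp; positivity
        · simp
  have h4 : (1 + ‖y‖) ^ p ≤ (1 + R) ^ p * (2 ^ p * (1 + ‖x - y‖ ^ p)) :=
    calc (1 + ‖y‖) ^ p ≤ ((1 + R) * (1 + ‖x - y‖)) ^ p := by gcongr
      _ = (1 + R) ^ p * (1 + ‖x - y‖) ^ p := mul_rpow (by positivity) (by positivity)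
      _ ≤ _ := by gcongr
  rw [rpow_neg (by positivity), ← div_eq_mul_inv, inv_eq_one_div,
    div_le_div_iff₀ (by positivity) (by positivity)]
  linarith

theorem norm_sub_le_of_decay {V W : Type*} [NormedAddCommGroup V] [NormedAddCommGroup W]
    {f : V → W} {C p : ℝ} (hC : 0 ≤ C) (hp : 0 ≤ p) (hf : ∀ w, ‖f w‖ ≤ C / (1 + ‖w‖ ^ p))
    {x : V} {R : ℝ} (hx : ‖x‖ ≤ R) (y : V) :
    ‖f (x - y)‖ ≤ C * (2 ^ p * (1 + R) ^ p * (1 + ‖y‖) ^ (-p)) :=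
  (hf _).trans <| by
    rw [div_eq_mul_inv]
    gcongr
    exact inv_one_add_norm_sub_rpow_le hp hx y

variable {V : Type*} [NormedAddCommGroup V] [NormedSpace ℝ V] [FiniteDimensional ℝ V]
  [MeasurableSpace V] [BorelSpace V] {μ : Measure V} [μ.IsAddHaarMeasure]

theorem integrable_decay_bound {p : ℝ} (hp : (Module.finrank ℝ V : ℝ) < p) (C R : ℝ) :
    Integrable (fun y : V => C * (2 ^ p * (1 + R) ^ p * (1 + ‖y‖) ^ (-p))) μ :=
  ((integrable_one_add_norm hp).const_mul _).const_mul _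

theorem integrable_comp_sub_of_decay {W : Type*} [NormedAddCommGroup W] {f : V → W} {C p : ℝ}
    (hC : 0 ≤ C) (hp : (Module.finrank ℝ V : ℝ) < p) (hf : ∀ w, ‖f w‖ ≤ C / (1 + ‖w‖ ^ p))
    (hfc : Continuous f) (x : V) : Integrable (fun y => f (x - y)) μ :=
  (integrable_decay_bound (μ := μ) hp C ‖x‖).mono' (by fun_prop)
    (.of_forall fun y => norm_sub_le_of_decay hC ((Nat.cast_nonneg _).trans hp.le) hf le_rfl y)

variable {P : V → ℝ} {C p q : ℝ} {τ : V → ℝ}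

/-- Differentiation under the integral sign for the convolution of a decaying `C¹` kernel with a
bounded function. -/
theorem hasFDerivAt_integral_comp_sub_mul (hP : ContDiff ℝ 1 P) (hC : 0 ≤ C)
    (hp : (Module.finrank ℝ V : ℝ) < p) (hq : (Module.finrank ℝ V : ℝ) < q)
    (hPp : ∀ w, ‖P w‖ ≤ C / (1 + ‖w‖ ^ p)) (hPq : ∀ w, ‖fderiv ℝ P w‖ ≤ C / (1 + ‖w‖ ^ q))
    (hτm : Measurable τ) (hτ : ∀ y, ‖τ y‖ ≤ 1) (x : V) :
    HasFDerivAt (fun x => ∫ y, P (x - y) * τ y ∂μ)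
      (∫ y, τ y • fderiv ℝ P (x - y) ∂μ) x := by
  have hP' : Continuous (fderiv ℝ P) := hP.continuous_fderiv one_ne_zero
  have hPc : Continuous P := hP.continuous
  refine hasFDerivAt_integral_of_dominated_of_fderiv_le (𝕜 := ℝ)
    (F := fun x y => P (x - y) * τ y) (F' := fun x y => τ y • fderiv ℝ P (x - y))
    (bound := fun y => C * (2 ^ q * (1 + (‖x‖ + 1)) ^ q * (1 + ‖y‖) ^ (-q)))
    (ball_mem_nhds x one_pos) (.of_forall fun z => ?_) ?_ ?_ ?_
    (integrable_decay_bound (μ := μ) hq _ _) ?_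
  · exact ((hPc.comp (continuous_const.sub continuous_id)).measurable.mul hτm).aestronglyMeasurable
  · exact (integrable_comp_sub_of_decay hC hp hPp hPc x).mul_bdd hτm.aestronglyMeasurable
      (.of_forall hτ)
  · exact hτm.aestronglyMeasurable.smul
      (hP'.comp (continuous_const.sub continuous_id)).aestronglyMeasurable
  · refine .of_forall fun y z hz => ?_
    have hz' : ‖z‖ ≤ ‖x‖ + 1 := by
      have := norm_le_norm_add_norm_sub' z x
      rw [mem_ball, dist_eq_norm] at hz
      linarith
    rw [norm_smul]
    exact (mul_le_of_le_one_left (norm_nonneg _) (hτ y)).trans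
      (norm_sub_le_of_decay hC ((Nat.cast_nonneg _).trans hq.le) hPq hz' y)
  · refine .of_forall fun y z _ => ?_
    have h1 : HasFDerivAt (fun z => P (z - y)) (fderiv ℝ P (z - y)) z :=
      (hP.differentiable one_ne_zero (z - y)).hasFDerivAt.comp z ((hasFDerivAt_id z).sub_const y)
    exact h1.mul_const (τ y)

theorem contDiff_integral_comp_sub_mul (hP : ContDiff ℝ 1 P) (hC : 0 ≤ C)
    (hp : (Module.finrank ℝ V : ℝ) < p) (hq : (Module.finrank ℝ V : ℝ) < q)
    (hPp : ∀ w, ‖P w‖ ≤ C / (1 + ‖w‖ ^ p)) (hPq : ∀ w, ‖fderiv ℝ P w‖ ≤ C / (1 + ‖w‖ ^ q))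
    (hτm : Measurable τ) (hτ : ∀ y, ‖τ y‖ ≤ 1) :
    ContDiff ℝ 1 (fun x => ∫ y, P (x - y) * τ y ∂μ) := by
  have hP' : Continuous (fderiv ℝ P) := hP.continuous_fderiv one_ne_zero
  refine contDiff_one_iff_hasFDerivAt.2 ⟨_, continuous_iff_continuousAt.2 fun x => ?_,
    hasFDerivAt_integral_comp_sub_mul (μ := μ) hP hC hp hq hPp hPq hτm hτ⟩
  refine continuousAt_of_dominated
    (bound := fun y => C * (2 ^ q * (1 + (‖x‖ + 1)) ^ q * (1 + ‖y‖) ^ (-q)))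
    (.of_forall fun z => ?_) ?_ (integrable_decay_bound (μ := μ) hq _ _) (.of_forall fun y => ?_)
  · exact hτm.aestronglyMeasurable.smul
      (hP'.comp (continuous_const.sub continuous_id)).aestronglyMeasurable
  · filter_upwards [ball_mem_nhds x one_pos] with z hz
    refine .of_forall fun y => ?_
    have hz' : ‖z‖ ≤ ‖x‖ + 1 := by
      have := norm_le_norm_add_norm_sub' z x
      rw [mem_ball, dist_eq_norm] at hz
      linarith
    rw [norm_smul]
    exact (mul_le_of_le_one_left (norm_nonneg _) (hτ y)).trans
      (norm_sub_le_of_decay hC ((Nat.cast_nonneg _).trans hq.le) hPq hz' y)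
  · fun_prop

theorem norm_integral_smul_fderiv_sub_le (hP : ContDiff ℝ 1 P) (hC : 0 ≤ C)
    (hq : (Module.finrank ℝ V : ℝ) < q) (hPq : ∀ w, ‖fderiv ℝ P w‖ ≤ C / (1 + ‖w‖ ^ q))
    {τ₁ τ₂ : V → ℝ} (hm₁ : Measurable τ₁) (hm₂ : Measurable τ₂) (h₁ : ∀ y, ‖τ₁ y‖ ≤ 1)
    (h₂ : ∀ y, ‖τ₂ y‖ ≤ 1) {x : V} {R : ℝ} (hx : ‖x‖ ≤ R) :
    ‖(∫ y, τ₁ y • fderiv ℝ P (x - y) ∂μ) - ∫ y, τ₂ y • fderiv ℝ P (x - y) ∂μ‖ ≤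
      ∫ y, ‖τ₁ y - τ₂ y‖ * (C * (2 ^ q * (1 + R) ^ q * (1 + ‖y‖) ^ (-q))) ∂μ := by
  have hP' : Continuous (fderiv ℝ P) := hP.continuous_fderiv one_ne_zero
  have hint {τ : V → ℝ} (hm : Measurable τ) (hτ : ∀ y, ‖τ y‖ ≤ 1) :
      Integrable (fun y => τ y • fderiv ℝ P (x - y)) μ :=
    (integrable_comp_sub_of_decay hC hq hPq hP' x).bdd_smul 1 hm.aestronglyMeasurable
      (.of_forall hτ)
  rw [← integral_sub (hint hm₁ h₁) (hint hm₂ h₂)]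
  refine norm_integral_le_of_norm_le ?_ (.of_forall fun y => ?_)
  · refine (integrable_decay_bound hq C R).bdd_mul (c := 2)
      (hm₁.sub hm₂).norm.aestronglyMeasurable (.of_forall fun y => ?_)
    have := norm_sub_le (τ₁ y) (τ₂ y)
    rw [norm_norm]
    linarith [h₁ y, h₂ y]
  · rw [← sub_smul, norm_smul]
    gcongr
    exact norm_sub_le_of_decay hC ((Nat.cast_nonneg _).trans hq.le) hPq hx y

/-- If the weights converge almost everywhere, the gradients of the convolutions converge
uniformly on bounded sets. -/
theorem tendsto_integral_norm_sub_mul_decay {ι : Type*} {l : Filter ι} [l.IsCountablyGenerated]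
    (hC : 0 ≤ C) (hq : (Module.finrank ℝ V : ℝ) < q) {R : ℝ} (hR : 0 ≤ R)
    {σ : ι → V → ℝ} {τ : V → ℝ} (hm : ∀ i, Measurable (σ i)) (hτm : Measurable τ)
    (hσ : ∀ i y, ‖σ i y‖ ≤ 1) (hτ : ∀ y, ‖τ y‖ ≤ 1)
    (hlim : ∀ᵐ y ∂μ, ∀ᶠ i in l, σ i y = τ y) :
    Filter.Tendsto
      (fun i => ∫ y, ‖σ i y - τ y‖ * (C * (2 ^ q * (1 + R) ^ q * (1 + ‖y‖) ^ (-q))) ∂μ)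
      l (𝓝 0) := by
  have hb := integrable_decay_bound (μ := μ) hq C R
  rw [← integral_zero V ℝ (μ := μ)]
  refine tendsto_integral_filter_of_dominated_convergence
    (fun y => 2 * (C * (2 ^ q * (1 + R) ^ q * (1 + ‖y‖) ^ (-q)))) (.of_forall fun i => ?_)
    (.of_forall fun i => .of_forall fun y => ?_) (hb.const_mul 2) ?_
  · exact ((hm i).sub hτm).norm.aestronglyMeasurable.mul hb.aestronglyMeasurable
  · have h0 : 0 ≤ C * (2 ^ q * (1 + R) ^ q * (1 + ‖y‖) ^ (-q)) := by positivity
    have := norm_sub_le (σ i y) (τ y)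
    rw [norm_mul, norm_norm, Real.norm_of_nonneg h0]
    gcongr
    linarith [hσ i y, hτ y]
  · filter_upwards [hlim] with y hy
    refine tendsto_const_nhds.congr' ?_
    filter_upwards [hy] with i hi
    simp [hi]

end Convolution

section HalfSpace

variable {d : ℕ}

/-- The sign of the last coordinate: the blow-up limit of `tauE E` at a boundary point. -/
def halfSign (y : EuclideanSpace ℝ (Fin (d + 1))) : ℝ :=
  if 0 < y (Fin.last d) then 1 else -1

theorem measurable_halfSign : Measurable (halfSign (d := d)) := by
  refine Measurable.ite (measurableSet_lt measurable_const ?_) measurable_const measurable_const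
  fun_prop

theorem norm_halfSign_le (y : EuclideanSpace ℝ (Fin (d + 1))) : ‖halfSign y‖ ≤ 1 := by
  unfold halfSign
  split_ifs <;> simp

/-- The box `(0,1]^d × (-h,0]`. -/
def slabBox (d : ℕ) (h : ℝ) : Set (EuclideanSpace ℝ (Fin (d + 1))) :=
  WithLp.ofLp ⁻¹' Set.univ.pi fun i : Fin (d + 1) =>
    Ioc (if i = Fin.last d then -h else 0) (if i = Fin.last d then 0 else 1)

theorem measurableSet_slabBox (h : ℝ) : MeasurableSet (slabBox d h) :=
  (MeasurableSet.univ_pi fun _ => measurableSet_Ioc).preimage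
    (PiLp.volume_preserving_ofLp (Fin (d + 1))).measurable

theorem volume_slabBox (h : ℝ) : volume (slabBox d h) = ENNReal.ofReal h := by
  rw [slabBox, (PiLp.volume_preserving_ofLp (Fin (d + 1))).measure_preimage
    (MeasurableSet.univ_pi fun _ => measurableSet_Ioc).nullMeasurableSet, Real.volume_pi_Ioc,
    Fin.prod_univ_castSucc]
  simp [(Fin.castSucc_lt_last _).ne]

theorem norm_le_of_mem_slabBox {h : ℝ} (h1 : h ≤ 1) {y : EuclideanSpace ℝ (Fin (d + 1))}
    (hy : y ∈ slabBox d h) : ‖y‖ ≤ √(d + 1) := by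
  rw [EuclideanSpace.norm_eq]
  gcongr
  have hle (i) : ‖y i‖ ^ 2 ≤ 1 := by
    have hi := hy i (mem_univ i)
    rw [sq_le_one_iff_abs_le_one, abs_norm, Real.norm_eq_abs, abs_le]
    simp only at hi
    split_ifs at hi <;> constructor <;> linarith [hi.1, hi.2]
  calc ∑ i, ‖y i‖ ^ 2 ≤ ∑ _i : Fin (d + 1), (1 : ℝ) := Finset.sum_le_sum fun i _ => hle i
    _ = d + 1 := by simp

theorem halfSign_add_smul_eN_sub {h : ℝ} {y : EuclideanSpace ℝ (Fin (d + 1))}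
    (hy : y ∈ slabBox d h) : halfSign (y + h • eN d) - halfSign y = 2 := by
  have hi := hy (Fin.last d) (mem_univ _)
  simp only [if_true] at hi
  have h1 : 0 < y (Fin.last d) + h := by linarith [hi.1]
  have h2 : ¬ 0 < y (Fin.last d) := not_lt.2 hi.2
  simp [halfSign, h1, h2]
  norm_num

theorem halfSign_le_halfSign_add_smul_eN {h : ℝ} (hh : 0 ≤ h)
    (y : EuclideanSpace ℝ (Fin (d + 1))) : halfSign y ≤ halfSign (y + h • eN d) := by
  simp only [halfSign, PiLp.add_apply, PiLp.smul_apply, eN_last, smul_eq_mul, mul_one]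
  split_ifs <;> linarith

/-- Convolving a positive kernel with the half-space sign gives a function whose increments in the
last direction are bounded below linearly. -/
theorem le_integral_halfSign_increment {P : EuclideanSpace ℝ (Fin (d + 1)) → ℝ}
    (hPint : ∀ x, Integrable fun y => P (x - y)) (hP0 : ∀ y, 0 ≤ P y) {c R : ℝ}
    (hc : ∀ w, ‖w‖ ≤ R + √(d + 1) → c ≤ P w) {x : EuclideanSpace ℝ (Fin (d + 1))}
    (hx : ‖x‖ ≤ R) {h : ℝ} (hh : 0 ≤ h) (h1 : h ≤ 1) :
    2 * c * h ≤ (∫ y, P (x + h • eN d - y) * halfSign y) - ∫ y, P (x - y) * halfSign y := by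
  have hint : Integrable fun y => P (x - y) * halfSign y :=
    (hPint x).mul_bdd measurable_halfSign.aestronglyMeasurable (.of_forall norm_halfSign_le)
  have hint' : Integrable fun y => P (x - y) * halfSign (y + h • eN d) :=
    (hPint x).mul_bdd (c := 1)
      (measurable_halfSign.comp (measurable_add_const (h • eN d))).aestronglyMeasurable
      (.of_forall fun _ => norm_halfSign_le _)
  rw [← integral_add_right_eq_self (fun y => P (x + h • eN d - y) * halfSign y) (h • eN d)]
  simp only [add_sub_add_right_eq_sub]
  rw [← integral_sub hint' hint]
  calc 2 * c * h = ∫ y, (slabBox d h).indicator (fun _ => 2 * c) y := by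
        rw [integral_indicator (measurableSet_slabBox h), setIntegral_const, measureReal_def,
          volume_slabBox, ENNReal.toReal_ofReal hh, smul_eq_mul, mul_comm]
    _ ≤ _ := by
        refine integral_mono ?_ (hint'.sub hint) fun y => ?_
        · rw [integrable_indicator_iff (measurableSet_slabBox h)]
          exact integrableOn_const (by simp [volume_slabBox])
        · simp only [← mul_sub]
          by_cases hy : y ∈ slabBox d h
          · rw [indicator_of_mem hy, halfSign_add_smul_eN_sub hy, mul_comm]
            have : ‖x - y‖ ≤ R + √(d + 1) :=
              (norm_sub_le _ _).trans (add_le_add hx (norm_le_of_mem_slabBox h1 hy))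
            linarith [hc _ this]
          · rw [indicator_of_notMem hy]
            exact mul_nonneg (hP0 _)
              (sub_nonneg.2 (halfSign_le_halfSign_add_smul_eN hh y))

theorem le_fderiv_integral_halfSign {P : EuclideanSpace ℝ (Fin (d + 1)) → ℝ}
    (hPint : ∀ x, Integrable fun y => P (x - y)) (hP0 : ∀ y, 0 ≤ P y) {c R : ℝ}
    (hc : ∀ w, ‖w‖ ≤ R + √(d + 1) → c ≤ P w) {x : EuclideanSpace ℝ (Fin (d + 1))}
    (hx : ‖x‖ ≤ R) {A : EuclideanSpace ℝ (Fin (d + 1)) →L[ℝ] ℝ}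
    (hA : HasFDerivAt (fun x => ∫ y, P (x - y) * halfSign y) A x) : 2 * c ≤ A (eN d) := by
  refine ge_of_tendsto (hA.hasLineDerivAt (eN d)).tendsto_slope_zero_right ?_
  filter_upwards [Ioc_mem_nhdsGT one_pos] with h hh
  have := le_integral_halfSign_increment hPint hP0 hc hx hh.1.le hh.2
  rw [smul_eq_mul, inv_mul_eq_div, le_div_iff₀ hh.1]
  exact this

end HalfSpace

section BlowUp

variable {d : ℕ} {E : Set (EuclideanSpace ℝ (Fin (d + 1)))}

theorem measurable_tauE (hE : IsOpen E) : Measurable (tauE E) :=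
  (measurable_const.indicator hE.measurableSet).sub
    (measurable_const.indicator isClosed_closure.measurableSet.compl)

theorem tauE_of_mem {y : EuclideanSpace ℝ (Fin (d + 1))} (hy : y ∈ E) : tauE E y = 1 := by
  simp [tauE, hy, subset_closure hy]

theorem tauE_of_notMem_closure {y : EuclideanSpace ℝ (Fin (d + 1))} (hy : y ∉ closure E) :
    tauE E y = -1 := by
  have hE : y ∉ E := fun h => hy (subset_closure h)
  simp [tauE, hy, hE]

theorem norm_tauE_le (y : EuclideanSpace ℝ (Fin (d + 1))) : ‖tauE E y‖ ≤ 1 := by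
  by_cases hy : y ∈ E
  · simp [tauE_of_mem hy]
  · by_cases hy' : y ∈ closure E
    · simp [tauE, hy, hy']
    · simp [tauE_of_notMem_closure hy']

variable {r : ℝ} {γ : EuclideanSpace ℝ (Fin d) → ℝ}

theorem mem_iff_lt_last
    (hEQ : ∀ (y' : EuclideanSpace ℝ (Fin d)) (a : ℝ), ‖y'‖ < r → |a| < r →
      (snocPt y' a ∈ E ↔ γ y' < a))
    {z : EuclideanSpace ℝ (Fin (d + 1))} (h1 : ‖projHead z‖ < r) (h2 : |z (Fin.last d)| < r) :
    z ∈ E ↔ γ (projHead z) < z (Fin.last d) := by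
  simpa only [snocPt_projHead] using hEQ (projHead z) (z (Fin.last d)) h1 h2

theorem notMem_closure_of_last_lt
    (hEQ : ∀ (y' : EuclideanSpace ℝ (Fin d)) (a : ℝ), ‖y'‖ < r → |a| < r →
      (snocPt y' a ∈ E ↔ γ y' < a))
    (hγ : ContinuousOn γ (ball 0 r))
    {z : EuclideanSpace ℝ (Fin (d + 1))} (h1 : ‖projHead z‖ < r) (h2 : |z (Fin.last d)| < r)
    (h3 : z (Fin.last d) < γ (projHead z)) : z ∉ closure E := by
  have hlast : Continuous fun w : EuclideanSpace ℝ (Fin (d + 1)) => w (Fin.last d) := by fun_prop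
  have hγz : ContinuousAt (fun w : EuclideanSpace ℝ (Fin (d + 1)) => γ (projHead w)) z :=
    (hγ.continuousAt (isOpen_ball.mem_nhds (by simpa using h1))).comp
      continuous_projHead.continuousAt
  rw [mem_closure_iff_frequently, Filter.not_frequently]
  filter_upwards [continuous_projHead.norm.continuousAt.eventually_lt continuousAt_const h1,
    hlast.abs.continuousAt.eventually_lt continuousAt_const h2,
    hlast.continuousAt.eventually_lt hγz h3] with w hw1 hw2 hw3
  rw [mem_iff_lt_last hEQ hw1 hw2]
  exact hw3.not_gt

/-- Blowing up `tauE E` at a boundary point with horizontal tangent plane gives the half-space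
sign. -/
theorem eventually_tauE_smul_eq_halfSign
    (hEQ : ∀ (y' : EuclideanSpace ℝ (Fin d)) (a : ℝ), ‖y'‖ < r → |a| < r →
      (snocPt y' a ∈ E ↔ γ y' < a))
    (hr : 0 < r) (hγ : ContinuousOn γ (ball 0 r)) (hγ0 : γ 0 = 0)
    (hdγ : HasFDerivAt γ (0 : EuclideanSpace ℝ (Fin d) →L[ℝ] ℝ) 0)
    {y : EuclideanSpace ℝ (Fin (d + 1))} (hy : y (Fin.last d) ≠ 0) :
    ∀ᶠ a : ℝ in 𝓝[>] 0, tauE E (a • y) = halfSign y := by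
  have hproj (a : ℝ) : projHead (a • y) = a • projHead y := by ext i; simp
  have hlim := (hdγ.hasLineDerivAt (projHead y)).tendsto_slope_zero_right
  simp only [zero_add, hγ0, sub_zero, smul_eq_mul, zero_apply] at hlim
  have e1 : ∀ᶠ a : ℝ in 𝓝[>] 0, ‖projHead (a • y)‖ < r := by
    have : Continuous fun a : ℝ => ‖projHead (a • y)‖ :=
      (continuous_projHead.comp (by fun_prop)).norm
    refine (this.continuousAt.eventually_lt continuousAt_const ?_).filter_mono nhdsWithin_le_nhds
    rwa [hproj, zero_smul, norm_zero]
  have e2 : ∀ᶠ a : ℝ in 𝓝[>] 0, |(a • y) (Fin.last d)| < r := by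
    have : Continuous fun a : ℝ => |(a • y) (Fin.last d)| := by fun_prop
    refine (this.continuousAt.eventually_lt continuousAt_const ?_).filter_mono nhdsWithin_le_nhds
    simpa using hr
  rcases hy.lt_or_gt with hy | hy
  · filter_upwards [e1, e2, hlim.eventually_const_lt hy, self_mem_nhdsWithin] with a h1 h2 h3 h4
    rw [halfSign, if_neg hy.not_gt]
    refine tauE_of_notMem_closure (notMem_closure_of_last_lt hEQ hγ h1 h2 ?_)
    rw [inv_mul_eq_div, lt_div_iff₀ h4] at h3
    simpa [hproj, mul_comm] using h3
  · filter_upwards [e1, e2, hlim.eventually_lt_const hy, self_mem_nhdsWithin] with a h1 h2 h3 h4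
    rw [halfSign, if_pos hy]
    refine tauE_of_mem ((mem_iff_lt_last hEQ h1 h2).2 ?_)
    rw [inv_mul_eq_div, div_lt_iff₀ h4] at h3
    simpa [hproj, mul_comm] using h3

theorem ae_last_ne_zero : ∀ᵐ y : EuclideanSpace ℝ (Fin (d + 1)), y (Fin.last d) ≠ 0 := by
  set S : Submodule ℝ (EuclideanSpace ℝ (Fin (d + 1))) :=
    LinearMap.ker (EuclideanSpace.proj (𝕜 := ℝ) (Fin.last d)).toLinearMap
  have hS : S ≠ ⊤ := fun h => by
    have : eN d ∈ S := h ▸ Submodule.mem_top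
    simp [S] at this
  have := Measure.addHaar_submodule (volume : Measure (EuclideanSpace ℝ (Fin (d + 1)))) S hS
  rw [ae_iff]
  convert this using 2
  ext y
  simp [S]

/-- Parabolic rescaling. -/
theorem uF_eq_integral_rescaled {s t : ℝ} (ht : 0 < t)
    (P : EuclideanSpace ℝ (Fin (d + 1)) → ℝ) (x : EuclideanSpace ℝ (Fin (d + 1))) :
    uF s P E x t =
      ∫ y, P ((t ^ (1 / (2 * s)))⁻¹ • x - y) * tauE E (t ^ (1 / (2 * s)) • y) := by
  set a := t ^ (1 / (2 * s)) with ha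
  have ha0 : 0 < a := rpow_pos_of_pos ht _
  have h1 : t ^ (-(1 : ℝ) / (2 * s)) = a⁻¹ := by
    rw [ha, neg_div, rpow_neg ht.le]
  have h2 : t ^ (-(((d : ℝ) + 1) / (2 * s))) = (a ^ (d + 1))⁻¹ := by
    rw [rpow_neg ht.le, ha, ← rpow_natCast, ← rpow_mul ht.le]
    congr 2
    push_cast
    ring
  have h3 := Measure.integral_comp_smul volume (fun y => ker s P (x - y) t * tauE E y) a
  rw [finrank_euclideanSpace_fin, abs_of_pos (by positivity), smul_eq_mul] at h3
  have h4 (y) : ker s P (x - a • y) t * tauE E (a • y) =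
      (a ^ (d + 1))⁻¹ * (P (a⁻¹ • x - y) * tauE E (a • y)) := by
    rw [ker, h1, h2, smul_sub, inv_smul_smul₀ ha0.ne', mul_assoc]
  simp only [h4] at h3
  rw [integral_const_mul] at h3
  exact (mul_left_cancel₀ (by positivity) h3).symm

end BlowUp

/-- for small `t > 0`, the zero level set of `u(·,t)` inside the ball
`B_{t^{1/(2s)}}` is locally a `C¹` graph over the first `N−1` coordinates. -/
theorem stmt1
    (d : ℕ) (hd : 1 ≤ d) (s : ℝ) (hs : s ∈ Set.Ioo (0 : ℝ) 1)
    (P : EuclideanSpace ℝ (Fin (d + 1)) → ℝ)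
    (hPrad : ∀ x y, ‖x‖ = ‖y‖ → P x = P y)
    (hP1 : ContDiff ℝ 1 P)
    (𝒞 : ℝ) (h𝒞 : 1 ≤ 𝒞)
    (hPlow : ∀ y, 𝒞⁻¹ / (1 + ‖y‖ ^ ((d : ℝ) + 1 + 2 * s)) ≤ P y)
    (hPup : ∀ y, P y ≤ 𝒞 / (1 + ‖y‖ ^ ((d : ℝ) + 1 + 2 * s)))
    (hPgrad : ∀ y, ‖fderiv ℝ P y‖ ≤ 𝒞 / (1 + ‖y‖ ^ ((d : ℝ) + 1 + 2 * s + 1)))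
    (E : Set (EuclideanSpace ℝ (Fin (d + 1))))
    (hEopen : IsOpen E) (hEbdd : Bornology.IsBounded E)
    (h0E : (0 : EuclideanSpace ℝ (Fin (d + 1))) ∈ frontier E)
    (r β : ℝ) (hr : 0 < r) (hβ : β ∈ Set.Ioc (0 : ℝ) 1)
    (γ : EuclideanSpace ℝ (Fin d) → ℝ)
    (hγdiff : ContDiffOn ℝ 1 γ (ball 0 r))
    (L : ℝ)
    (hγhold : ∀ x ∈ ball (0 : EuclideanSpace ℝ (Fin d)) r,
      ∀ y ∈ ball (0 : EuclideanSpace ℝ (Fin d)) r,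
      ‖fderivWithin ℝ γ (ball 0 r) x - fderivWithin ℝ γ (ball 0 r) y‖ ≤ L * ‖x - y‖ ^ β)
    (hγ0 : γ 0 = 0)
    (hdγ0 : fderivWithin ℝ γ (ball 0 r) 0 = 0)
    (m : ℝ) (hm : m < r)
    (hγm : ∀ y' ∈ ball (0 : EuclideanSpace ℝ (Fin d)) r, |γ y'| ≤ m)
    (hEQ : ∀ (y' : EuclideanSpace ℝ (Fin d)) (a : ℝ), ‖y'‖ < r → |a| < r →
      (snocPt y' a ∈ E ↔ γ y' < a))
    :
    ∃ t₀ > (0 : ℝ), ∀ t ∈ Set.Ioo (0 : ℝ) t₀,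
      ∀ z₀ : EuclideanSpace ℝ (Fin (d + 1)),
        uF s P E z₀ t = 0 → ‖z₀‖ < t ^ (1 / (2 * s)) →
        ∃ U : Set (EuclideanSpace ℝ (Fin (d + 1))), IsOpen U ∧ z₀ ∈ U ∧
        ∃ V : Set (EuclideanSpace ℝ (Fin d)), IsOpen V ∧ projHead z₀ ∈ V ∧
        ∃ g : EuclideanSpace ℝ (Fin d) → ℝ, ContDiffOn ℝ 1 g V ∧
          {z ∈ U | uF s P E z t = 0} =
            ((fun z' => snocPt z' (g z')) '' V) ∩ U := by
  have hs0 : 0 < s := hs.1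
  have hC : 0 ≤ 𝒞 := zero_le_one.trans h𝒞
  have hCpos : 0 < 𝒞 := zero_lt_one.trans_le h𝒞
  set p : ℝ := (d : ℝ) + 1 + 2 * s with hp
  have hp0 : 0 ≤ p := by positivity
  have hpd : (Module.finrank ℝ (EuclideanSpace ℝ (Fin (d + 1))) : ℝ) < p := by
    rw [finrank_euclideanSpace_fin, hp]
    push_cast
    linarith
  have hqd : (Module.finrank ℝ (EuclideanSpace ℝ (Fin (d + 1))) : ℝ) < p + 1 := by linarith
  have hP0 (y) : 0 ≤ P y := le_trans (by positivity) (hPlow y)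
  have hPp (y) : ‖P y‖ ≤ 𝒞 / (1 + ‖y‖ ^ p) := by
    rw [Real.norm_of_nonneg (hP0 y)]
    exact hPup y
  have hPint (x) : Integrable fun y => P (x - y) :=
    integrable_comp_sub_of_decay hC hpd hPp hP1.continuous x
  obtain ⟨c, hc0, hc⟩ : ∃ c > 0, ∀ w : EuclideanSpace ℝ (Fin (d + 1)),
      ‖w‖ ≤ 1 + √(d + 1) → c ≤ P w := by
    refine ⟨𝒞⁻¹ / (1 + (1 + √(d + 1)) ^ p), by positivity, fun w hw => le_trans ?_ (hPlow w)⟩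
    gcongr
  have h0r : (0 : EuclideanSpace ℝ (Fin d)) ∈ ball 0 r := mem_ball_self hr
  have hdγ : HasFDerivAt γ (0 : EuclideanSpace ℝ (Fin d) →L[ℝ] ℝ) 0 := by
    rw [← hdγ0]
    exact ((hγdiff.differentiableOn one_ne_zero) 0 h0r).hasFDerivWithinAt.hasFDerivAt
      (isOpen_ball.mem_nhds h0r)
  have hσm (a : ℝ) : Measurable fun y => tauE E (a • y) :=
    (measurable_tauE hEopen).comp (measurable_const_smul a)
  have hσ (a : ℝ) (y) : ‖tauE E (a • y)‖ ≤ 1 := norm_tauE_le _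
  have hlim := tendsto_integral_norm_sub_mul_decay (μ := volume) (R := 1) hC hqd zero_le_one hσm
    measurable_halfSign hσ norm_halfSign_le
    (by
      filter_upwards [ae_last_ne_zero] with y hy
      exact eventually_tauE_smul_eq_halfSign hEQ hr hγdiff.continuousOn hγ0 hdγ hy)
  obtain ⟨a₀, ha₀, hsmall⟩ :=
    mem_nhdsGT_iff_exists_Ioo_subset.1 (hlim.eventually_lt_const (show 0 < 2 * c by positivity))
  have ha₀' : 0 < a₀ := ha₀
  refine ⟨a₀ ^ (2 * s), by positivity, fun t ht z₀ hz₀ hzt => ?_⟩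
  set a := t ^ (1 / (2 * s)) with ha
  have hapos : 0 < a := rpow_pos_of_pos ht.1 _
  have hlt : a < a₀ := by
    rw [ha, one_div, rpow_inv_lt_iff_of_pos ht.1.le ha₀'.le (by positivity)]
    exact ht.2
  have hv := hasFDerivAt_integral_comp_sub_mul (μ := volume) hP1 hC hpd hqd hPp hPgrad (hσm a)
    (hσ a) (a⁻¹ • z₀)
  have hv0 := hasFDerivAt_integral_comp_sub_mul (μ := volume) hP1 hC hpd hqd hPp hPgrad
    measurable_halfSign norm_halfSign_le (a⁻¹ • z₀)
  have hx : ‖a⁻¹ • z₀‖ ≤ 1 := by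
    rw [norm_smul, norm_inv, Real.norm_of_nonneg hapos.le, inv_mul_le_iff₀ hapos, mul_one]
    exact hzt.le
  have hlow := le_fderiv_integral_halfSign hPint hP0 hc hx hv0
  have hdist := norm_integral_smul_fderiv_sub_le (μ := volume) hP1 hC hqd hPgrad (hσm a)
    measurable_halfSign (hσ a) norm_halfSign_le hx
  set A := ∫ y, tauE E (a • y) • fderiv ℝ P (a⁻¹ • z₀ - y)
  set A₀ := ∫ y, halfSign y • fderiv ℝ P (a⁻¹ • z₀ - y)
  have hApos : 0 < A (eN d) := by
    have h1 : ‖A - A₀‖ < 2 * c := hdist.trans_lt (hsmall ⟨hapos, hlt⟩)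
    have h2 : |A (eN d) - A₀ (eN d)| ≤ ‖A - A₀‖ := by
      simpa using (A - A₀).le_opNorm (eN d)
    linarith [(abs_le.1 h2).1]
  have huv : (fun z => uF s P E z t) = fun z => ∫ y, P (a⁻¹ • z - y) * tauE E (a • y) :=
    funext fun z => uF_eq_integral_rescaled ht.1 P z
  have hu1 : ContDiff ℝ 1 fun z => uF s P E z t := by
    rw [huv]
    exact (contDiff_integral_comp_sub_mul hP1 hC hpd hqd hPp hPgrad (hσm a) (hσ a)).comp
      (contDiff_const_smul a⁻¹)
  refine exists_contDiffOn_graph_of_fderiv_ne_zero hu1 hz₀ ?_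
  have hder : HasFDerivAt (fun z => uF s P E z t)
      (A.comp (a⁻¹ • ContinuousLinearMap.id ℝ (EuclideanSpace ℝ (Fin (d + 1))))) z₀ := by
    rw [huv]
    exact hv.comp z₀ ((hasFDerivAt_id z₀).const_smul a⁻¹)
  rw [hder.fderiv]
  simpa [hapos.ne'] using hApos.ne'
end
end

section
/- Let s ∈ (0,1/2) and assume β > 2s. For every constant C₀ > 0 there exist C > 0 and t₀ > 0 such that for all t ∈ (0,t₀), all θ ∈ [0,1], and all v ∈ ℝ with |v t| ≤ C₀ σ_s(t)^{(1+2s)/(2s)}, setting ε(y') = γ(y') − v t θ, one has | ∫_0^1 ∫_{B_r^{N-1}} ε(y') (∂𝒦_s/∂y_N)((y', θ' ε(y')), σ_s(t)) dy' dθ' | ≤ C σ_s(t)^{(2s−1)/(2s)}. -/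
open MeasureTheory Metric Real Set

noncomputable section

/-- The partial derivative `∂𝒦_s/∂y_N` of the kernel in the last coordinate. -/
def kerDN {d : ℕ} (s : ℝ) (P : EuclideanSpace ℝ (Fin (d + 1)) → ℝ)
    (x : EuclideanSpace ℝ (Fin (d + 1))) (t : ℝ) : ℝ :=
  fderiv ℝ (fun z => ker s P z t) x (eN d)

lemma norm_le_norm_snocPt {d : ℕ} (y : EuclideanSpace ℝ (Fin d)) (a : ℝ) :
    ‖y‖ ≤ ‖snocPt y a‖ := by
  rw [EuclideanSpace.norm_eq, EuclideanSpace.norm_eq]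
  apply Real.sqrt_le_sqrt
  rw [Fin.sum_univ_castSucc]
  simp [snocPt]
  positivity

lemma inv_one_add_rpow_le {a p : ℝ} (ha : 0 ≤ a) (hp : 0 ≤ p) :
    1 / (1 + a ^ p) ≤ 2 ^ p * (1 + a) ^ (-p) := by
  have hap : 0 ≤ a ^ p := rpow_nonneg ha p
  have h : (1 + a) ^ p ≤ 2 ^ p * (1 + a ^ p) := by
    rcases le_total a 1 with h1 | h1
    · calc (1 + a) ^ p ≤ 2 ^ p := rpow_le_rpow (by positivity) (by linarith) hp
        _ ≤ 2 ^ p * (1 + a ^ p) := le_mul_of_one_le_right (by positivity) (by linarith)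
    · calc (1 + a) ^ p ≤ (2 * a) ^ p := rpow_le_rpow (by positivity) (by linarith) hp
        _ = 2 ^ p * a ^ p := mul_rpow (by norm_num) ha
        _ ≤ 2 ^ p * (1 + a ^ p) := by gcongr; linarith
  have h0 : 0 < (1 + a) ^ p := by positivity
  rw [rpow_neg (by positivity), ← div_eq_mul_inv, div_le_div_iff₀ (by positivity) h0]
  linarith

/-- A function with vanishing `β`-Hölder gradient at the origin is `O(‖y‖ ^ (1 + β))`. -/
lemma abs_le_of_holder_fderivWithin {E : Type*} [NormedAddCommGroup E] [NormedSpace ℝ E]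
    {γ : E → ℝ} {r β L : ℝ} (hβ : 0 < β) (hγ : DifferentiableOn ℝ γ (ball 0 r))
    (hhold : ∀ x ∈ ball (0 : E) r, ∀ y ∈ ball (0 : E) r,
      ‖fderivWithin ℝ γ (ball 0 r) x - fderivWithin ℝ γ (ball 0 r) y‖ ≤ L * ‖x - y‖ ^ β)
    (hγ0 : γ 0 = 0) (hdγ0 : fderivWithin ℝ γ (ball 0 r) 0 = 0)
    {y : E} (hy : y ∈ ball (0 : E) r) :
    |γ y| ≤ |L| * ‖y‖ ^ β * ‖y‖ := by
  have hyr : ‖y‖ < r := by simpa using hy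
  have hsub : closedBall (0 : E) ‖y‖ ⊆ ball 0 r := closedBall_subset_ball hyr
  have h0 : (0 : E) ∈ ball (0 : E) r := hsub (by simp)
  have := (convex_closedBall (0 : E) ‖y‖).norm_image_sub_le_of_norm_hasFDerivWithin_le
    (f := γ) (f' := fderivWithin ℝ γ (ball 0 r)) (C := |L| * ‖y‖ ^ β) (x := 0) (y := y)
    (fun x hx => ((hγ x (hsub hx)).hasFDerivWithinAt).mono hsub)
    (fun x hx => by
      have h1 := hhold x (hsub hx) 0 h0
      rw [hdγ0, sub_zero, sub_zero] at h1
      refine h1.trans ?_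
      have hx' : ‖x‖ ≤ ‖y‖ := by simpa using hx
      exact mul_le_mul (le_abs_self L) (rpow_le_rpow (norm_nonneg _) hx' hβ.le)
        (by positivity) (abs_nonneg L))
    (by simp) (by simp)
  simpa [hγ0] using this

lemma abs_kerDN_le {d : ℕ} {s 𝒞 p : ℝ} {P : EuclideanSpace ℝ (Fin (d + 1)) → ℝ}
    (hs : 0 < s) (hp : 0 ≤ p) (h𝒞 : 0 ≤ 𝒞) (hP : Differentiable ℝ P)
    (hPgrad : ∀ y, ‖fderiv ℝ P y‖ ≤ 𝒞 / (1 + ‖y‖ ^ p))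
    {ρ : ℝ} (hρ : 0 < ρ) (y : EuclideanSpace ℝ (Fin d)) (a : ℝ) :
    |kerDN s P (snocPt y a) (ρ ^ (2 * s))| ≤
      ρ ^ (-((d : ℝ) + 2)) * (𝒞 * 2 ^ p * (1 + ‖ρ⁻¹ • y‖) ^ (-p)) := by
  have e1 : (ρ ^ (2 * s)) ^ (-(((d : ℝ) + 1) / (2 * s))) = ρ ^ (-((d : ℝ) + 1)) := by
    rw [← rpow_mul hρ.le]; congr 1; field_simp
  have e2 : (ρ ^ (2 * s)) ^ (-(1 : ℝ) / (2 * s)) = ρ⁻¹ := by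
    rw [← rpow_mul hρ.le, ← rpow_neg_one]; congr 1; field_simp
  set x := snocPt y a with hx
  have hd : HasFDerivAt (fun z => ker s P z (ρ ^ (2 * s)))
      (ρ ^ (-((d : ℝ) + 1)) • (ρ⁻¹ • fderiv ℝ P (ρ⁻¹ • x))) x := by
    have h1 := (hP (ρ⁻¹ • x)).hasFDerivAt.comp x
      ((hasFDerivAt_id (𝕜 := ℝ) x).const_smul (ρ⁻¹))
    have h2 := h1.const_mul (ρ ^ (-((d : ℝ) + 1)))
    simp only [ker, e1, e2]
    refine h2.congr_fderiv ?_
    ext v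
    simp
  have e3 : ρ ^ (-((d : ℝ) + 2)) = ρ ^ (-((d : ℝ) + 1)) * ρ⁻¹ := by
    rw [← rpow_neg_one, ← rpow_add hρ]; congr 1; ring
  have h4 : |fderiv ℝ P (ρ⁻¹ • x) (eN d)| ≤ 𝒞 * 2 ^ p * (1 + ‖ρ⁻¹ • y‖) ^ (-p) := by
    have h5 := (fderiv ℝ P (ρ⁻¹ • x)).le_opNorm (eN d)
    have h6 : ‖eN d‖ = 1 := by simp [eN]
    rw [h6, mul_one] at h5
    have h7 : ‖ρ⁻¹ • y‖ ≤ ‖ρ⁻¹ • x‖ := by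
      rw [norm_smul, norm_smul]
      gcongr
      exact norm_le_norm_snocPt y a
    calc |fderiv ℝ P (ρ⁻¹ • x) (eN d)| ≤ 𝒞 / (1 + ‖ρ⁻¹ • x‖ ^ p) := h5.trans (hPgrad _)
      _ ≤ 𝒞 / (1 + ‖ρ⁻¹ • y‖ ^ p) := by gcongr
      _ = 𝒞 * (1 / (1 + ‖ρ⁻¹ • y‖ ^ p)) := by ring
      _ ≤ 𝒞 * (2 ^ p * (1 + ‖ρ⁻¹ • y‖) ^ (-p)) := by
        gcongr
        exact inv_one_add_rpow_le (norm_nonneg _) hp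
      _ = _ := by ring
  have h0 : 0 < ρ ^ (-((d : ℝ) + 1)) := by positivity
  rw [kerDN, hd.fderiv, e3]
  simp only [smul_apply, smul_eq_mul, abs_mul, abs_of_pos h0,
    abs_of_pos (inv_pos.2 hρ)]
  rw [mul_assoc]
  gcongr

lemma integral_comp_inv_smul_one_add_norm {d : ℕ} {ρ : ℝ} (hρ : 0 < ρ) (q : ℝ) :
    ∫ y : EuclideanSpace ℝ (Fin d), (1 + ‖ρ⁻¹ • y‖) ^ q =
      ρ ^ (d : ℝ) * ∫ y : EuclideanSpace ℝ (Fin d), (1 + ‖y‖) ^ q := by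
  have := Measure.integral_comp_inv_smul_of_nonneg
    (volume : Measure (EuclideanSpace ℝ (Fin d))) (fun y => (1 + ‖y‖) ^ q) hρ.le
  rw [this]
  simp

/-- the error term `∫_0^1 ∫_{B_r^{N-1}} ε(y') ∂_N𝒦_s((y',θ'ε(y')),σ_s(t)) dy' dθ'`
with `ε(y') = γ(y') − vtθ` is `O(σ_s(t)^{(2s−1)/(2s)})` for `s ∈ (0,1/2)`, `β > 2s`,
where `σ_s(t) = t^{2s/(1+2s)}`. -/
theorem stmt9
    (d : ℕ) (hd : 1 ≤ d) (s : ℝ) (hs : s ∈ Set.Ioo (0 : ℝ) 1)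
    (P : EuclideanSpace ℝ (Fin (d + 1)) → ℝ)
    (hPrad : ∀ x y, ‖x‖ = ‖y‖ → P x = P y)
    (hP1 : ContDiff ℝ 1 P)
    (𝒞 : ℝ) (h𝒞 : 1 ≤ 𝒞)
    (hPlow : ∀ y, 𝒞⁻¹ / (1 + ‖y‖ ^ ((d : ℝ) + 1 + 2 * s)) ≤ P y)
    (hPup : ∀ y, P y ≤ 𝒞 / (1 + ‖y‖ ^ ((d : ℝ) + 1 + 2 * s)))
    (hPgrad : ∀ y, ‖fderiv ℝ P y‖ ≤ 𝒞 / (1 + ‖y‖ ^ ((d : ℝ) + 1 + 2 * s + 1)))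
    (r β : ℝ) (hr : 0 < r) (hβ : β ∈ Set.Ioc (0 : ℝ) 1)
    (γ : EuclideanSpace ℝ (Fin d) → ℝ)
    (hγdiff : ContDiffOn ℝ 1 γ (ball 0 r))
    (L : ℝ)
    (hγhold : ∀ x ∈ ball (0 : EuclideanSpace ℝ (Fin d)) r,
      ∀ y ∈ ball (0 : EuclideanSpace ℝ (Fin d)) r,
      ‖fderivWithin ℝ γ (ball 0 r) x - fderivWithin ℝ γ (ball 0 r) y‖ ≤ L * ‖x - y‖ ^ β)
    (hγ0 : γ 0 = 0)
    (hdγ0 : fderivWithin ℝ γ (ball 0 r) 0 = 0)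
    (hs12 : s < 1 / 2) (hβ2s : 2 * s < β) :
    ∀ C₀ > (0 : ℝ), ∃ C > (0 : ℝ), ∃ t₀ > (0 : ℝ), ∀ t ∈ Set.Ioo (0 : ℝ) t₀,
      ∀ θ ∈ Set.Icc (0 : ℝ) 1, ∀ v : ℝ,
      |v * t| ≤ C₀ * (t ^ (2 * s / (1 + 2 * s))) ^ ((1 + 2 * s) / (2 * s)) →
      |∫ θ' in (0 : ℝ)..1, ∫ y' in ball (0 : EuclideanSpace ℝ (Fin d)) r,
          (γ y' - v * t * θ) *
            kerDN s P (snocPt y' (θ' * (γ y' - v * t * θ))) (t ^ (2 * s / (1 + 2 * s)))| ≤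
        C * (t ^ (2 * s / (1 + 2 * s))) ^ ((2 * s - 1) / (2 * s)) := by
  intro C₀ hC₀
  have hs0 : 0 < s := hs.1
  set p : ℝ := (d : ℝ) + 1 + 2 * s + 1 with hpdef
  have hp : 0 ≤ p := by positivity
  set q : ℝ := -((d : ℝ) + 1) with hq
  set I : ℝ := ∫ y : EuclideanSpace ℝ (Fin d), (1 + ‖y‖) ^ q with hI
  have hI0 : 0 ≤ I := integral_nonneg fun y => by positivity
  have hint : Integrable (fun y : EuclideanSpace ℝ (Fin d) => (1 + ‖y‖) ^ q) :=
    integrable_one_add_norm (by simp)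
  set K : ℝ := |L| * r ^ (β - 2 * s) + C₀ with hK
  have hK0 : 0 ≤ K := by positivity
  have h𝒞0 : 0 ≤ 𝒞 := by linarith
  refine ⟨K * (𝒞 * 2 ^ p) * I + 1, by positivity, 1, one_pos, ?_⟩
  intro t ht θ hθ v hv
  have ht0 : 0 < t := ht.1
  set ρ : ℝ := t ^ (1 / (1 + 2 * s)) with hρdef
  have hρ : 0 < ρ := rpow_pos_of_pos ht0 _
  have eσ : t ^ (2 * s / (1 + 2 * s)) = ρ ^ (2 * s) := by
    rw [hρdef, ← rpow_mul ht0.le]; congr 1; ring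
  rw [eσ] at hv ⊢
  have e1 : (ρ ^ (2 * s)) ^ ((1 + 2 * s) / (2 * s)) = ρ ^ (1 + 2 * s) := by
    rw [← rpow_mul hρ.le]; congr 1; field_simp
  have e2 : (ρ ^ (2 * s)) ^ ((2 * s - 1) / (2 * s)) = ρ ^ (2 * s - 1) := by
    rw [← rpow_mul hρ.le]; congr 1; field_simp
  rw [e1] at hv
  rw [e2]
  have hε : ∀ y ∈ ball (0 : EuclideanSpace ℝ (Fin d)) r,
      |γ y - v * t * θ| ≤ K * (ρ ^ (1 + 2 * s) * (1 + ‖ρ⁻¹ • y‖) ^ (1 + 2 * s)) := by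
    intro y hy
    have hyr : ‖y‖ ≤ r := by simpa using (mem_ball_zero_iff.1 hy).le
    have hγy := abs_le_of_holder_fderivWithin hβ.1 (hγdiff.differentiableOn one_ne_zero)
      hγhold hγ0 hdγ0 hy
    have hny : ‖y‖ = ρ * ‖ρ⁻¹ • y‖ := by
      rw [norm_smul, norm_inv, norm_of_nonneg hρ.le]; field_simp
    have h1 : ‖y‖ ^ β * ‖y‖ ≤
        r ^ (β - 2 * s) * (ρ ^ (1 + 2 * s) * (1 + ‖ρ⁻¹ • y‖) ^ (1 + 2 * s)) := by
      calc ‖y‖ ^ β * ‖y‖ = ‖y‖ ^ (β - 2 * s) * ‖y‖ ^ (1 + 2 * s) := by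
            rw [← rpow_add_one' (norm_nonneg y) (by linarith [hβ.1]),
              ← rpow_add' (norm_nonneg y) (by linarith [hβ.1])]
            congr 1; ring
        _ ≤ r ^ (β - 2 * s) * (ρ * (1 + ‖ρ⁻¹ • y‖)) ^ (1 + 2 * s) := by
            gcongr
            rw [mul_one_add, ← hny]
            linarith
        _ = _ := by rw [mul_rpow hρ.le (by positivity)]
    have h2 : |v * t * θ| ≤ C₀ * (ρ ^ (1 + 2 * s) * (1 + ‖ρ⁻¹ • y‖) ^ (1 + 2 * s)) := by
      rw [abs_mul, abs_of_nonneg hθ.1]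
      calc |v * t| * θ ≤ |v * t| := mul_le_of_le_one_right (abs_nonneg _) hθ.2
        _ ≤ C₀ * ρ ^ (1 + 2 * s) := hv
        _ ≤ _ := by
          gcongr
          refine le_mul_of_one_le_right (by positivity) (one_le_rpow ?_ (by linarith))
          linarith [norm_nonneg (ρ⁻¹ • y)]
    calc |γ y - v * t * θ| ≤ |γ y| + |v * t * θ| := abs_sub _ _
      _ ≤ |L| * (r ^ (β - 2 * s) * (ρ ^ (1 + 2 * s) * (1 + ‖ρ⁻¹ • y‖) ^ (1 + 2 * s)))
          + C₀ * (ρ ^ (1 + 2 * s) * (1 + ‖ρ⁻¹ • y‖) ^ (1 + 2 * s)) := by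
        refine add_le_add (hγy.trans ?_) h2
        rw [mul_assoc]
        gcongr
      _ = _ := by rw [hK]; ring
  set A : ℝ := K * (𝒞 * 2 ^ p) * ρ ^ (2 * s - 1 - d) with hA
  have hbound : ∀ θ' : ℝ, ∀ y ∈ ball (0 : EuclideanSpace ℝ (Fin d)) r,
      ‖(γ y - v * t * θ) * kerDN s P (snocPt y (θ' * (γ y - v * t * θ))) (ρ ^ (2 * s))‖ ≤
        A * (1 + ‖ρ⁻¹ • y‖) ^ q := by
    intro θ' y hy
    rw [norm_mul, Real.norm_eq_abs, Real.norm_eq_abs]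
    have hb : 0 < 1 + ‖ρ⁻¹ • y‖ := by positivity
    refine (mul_le_mul (hε y hy) (abs_kerDN_le hs0 hp h𝒞0 (hP1.differentiable one_ne_zero)
      hPgrad hρ y _) (abs_nonneg _) (by positivity)).trans_eq ?_
    have f1 : ρ ^ (2 * s - 1 - d) = ρ ^ (1 + 2 * s) * ρ ^ (-((d : ℝ) + 2)) := by
      rw [← rpow_add hρ]; congr 1; ring
    have f2 : (1 + ‖ρ⁻¹ • y‖) ^ q = (1 + ‖ρ⁻¹ • y‖) ^ (1 + 2 * s) * (1 + ‖ρ⁻¹ • y‖) ^ (-p) := by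
      rw [← rpow_add hb]; congr 1; rw [hq, hpdef]; ring
    rw [hA, f1, f2]; ring
  have hintρ : Integrable
      (fun y : EuclideanSpace ℝ (Fin d) => A * (1 + ‖ρ⁻¹ • y‖) ^ q) :=
    (hint.comp_smul (inv_ne_zero hρ.ne')).const_mul A
  have hinner : ∀ θ' : ℝ,
      ‖∫ y in ball (0 : EuclideanSpace ℝ (Fin d)) r, (γ y - v * t * θ) *
        kerDN s P (snocPt y (θ' * (γ y - v * t * θ))) (ρ ^ (2 * s))‖ ≤
      K * (𝒞 * 2 ^ p) * I * ρ ^ (2 * s - 1) := by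
    intro θ'
    calc _ ≤ ∫ y in ball (0 : EuclideanSpace ℝ (Fin d)) r, A * (1 + ‖ρ⁻¹ • y‖) ^ q :=
          norm_integral_le_of_norm_le hintρ.integrableOn
            ((ae_restrict_iff' measurableSet_ball).2 (.of_forall (hbound θ')))
      _ ≤ ∫ y : EuclideanSpace ℝ (Fin d), A * (1 + ‖ρ⁻¹ • y‖) ^ q :=
          setIntegral_le_integral hintρ (.of_forall fun y => by
            simp only [Pi.zero_apply]; positivity)
      _ = A * (ρ ^ (d : ℝ) * I) := by
          rw [integral_const_mul, integral_comp_inv_smul_one_add_norm hρ]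
      _ = _ := by
          have : ρ ^ (2 * s - 1) = ρ ^ (2 * s - 1 - d) * ρ ^ (d : ℝ) := by
            rw [← rpow_add hρ]; congr 1; ring
          rw [hA, this]; ring
  have := intervalIntegral.norm_integral_le_of_norm_le_const (a := 0) (b := 1)
    fun θ' _ => hinner θ'
  rw [sub_zero, abs_one, mul_one, Real.norm_eq_abs] at this
  refine this.trans ?_
  gcongr
  linarith
end
end
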